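/- R × R₂ = S + {((w, 0), 0) : w ∈ R₁}; that is, every element ((x, y), z) ∈ R₁ × R₁♯ × R₂ can be written as s + ((w, 0), 0) with s ∈ S and w ∈ R₁, and conversely every such sum lies in R × R₂. -/

import Mathlib

open Matrix

noncomputable section

/-- `ψ_M(x, y) = xᵀ M y`, the bilinear form on `ℚᵏ` associated with an integer matrix `M`. -/
def psi {k : ℕ} (M : Matrix (Fin k) (Fin k) ℤ) (x y : Fin k → ℚ) : ℚ :=
  x ⬝ᵥ ((M.map (fun a => (a : ℚ))) *ᵥ y)

/-- A rational number is an integer. -/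
def IsIntQ (q : ℚ) : Prop := ∃ a : ℤ, q = a

/-- A rational vector has integer entries, i.e. belongs to the lattice `ℤᵏ ⊂ ℚᵏ`. -/
def IsIntVec {k : ℕ} (x : Fin k → ℚ) : Prop := ∀ i, IsIntQ (x i)

/-- `x` belongs to the dual lattice of `ℤᵏ` with respect to `ψ_M`. -/
def InDual {k : ℕ} (M : Matrix (Fin k) (Fin k) ℤ) (x : Fin k → ℚ) : Prop :=
  ∀ y, IsIntVec y → IsIntQ (psi M x y)

/-- The form `ψ_R` on `V₁ × V₁`:
`ψ_R((x,y),(x',y')) = ψ_A(x,y') + ψ_A(x',y) + ψ_A(y,y') − ψ_B(f(y),f(y'))`. -/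
def psiR {n m : ℕ} (A : Matrix (Fin n) (Fin n) ℤ) (B : Matrix (Fin m) (Fin m) ℤ)
    (f : (Fin n → ℚ) →ₗ[ℚ] (Fin m → ℚ)) (u v : (Fin n → ℚ) × (Fin n → ℚ)) : ℚ :=
  psi A u.1 v.2 + psi A v.1 u.2 + psi A u.2 v.2 - psi B (f u.2) (f v.2)

/-- Membership in the lattice `R = R₁ × R₁♯ ⊂ V₁ × V₁`. -/
def InR {n : ℕ} (A : Matrix (Fin n) (Fin n) ℤ) (u : (Fin n → ℚ) × (Fin n → ℚ)) : Prop :=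
  IsIntVec u.1 ∧ InDual A u.2

/-- The ambient space `W = (V₁ × V₁) × V₂`. -/
abbrev WSp (n m : ℕ) : Type := ((Fin n → ℚ) × (Fin n → ℚ)) × (Fin m → ℚ)

/-- The orthogonal direct sum form `Ψ = ψ_R ⊕ ψ_B` on `W`. -/
def PsiW {n m : ℕ} (A : Matrix (Fin n) (Fin n) ℤ) (B : Matrix (Fin m) (Fin m) ℤ)
    (f : (Fin n → ℚ) →ₗ[ℚ] (Fin m → ℚ)) (w w' : WSp n m) : ℚ :=
  psiR A B f w.1 w'.1 + psi B w.2 w'.2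

/-- The map `ι : V₁ → W`, `ι(y) = ((0, y), f(y))`. -/
def iota {n m : ℕ} (f : (Fin n → ℚ) →ₗ[ℚ] (Fin m → ℚ)) (y : Fin n → ℚ) : WSp n m :=
  ((0, y), f y)

/-- Membership in `S = {z ∈ R × R₂♯ : Ψ(z, ι(r)) = 0 for all r ∈ R₁♯}`. -/
def InS {n m : ℕ} (A : Matrix (Fin n) (Fin n) ℤ) (B : Matrix (Fin m) (Fin m) ℤ)
    (f : (Fin n → ℚ) →ₗ[ℚ] (Fin m → ℚ)) (w : WSp n m) : Prop :=
  (InR A w.1 ∧ InDual B w.2) ∧ ∀ r, InDual A r → PsiW A B f w (iota f r) = 0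

theorem aux_add_left {k : ℕ} (M : Matrix (Fin k) (Fin k) ℤ) (x y z : Fin k → ℚ) :
    psi M (x + y) z = psi M x z + psi M y z := by
  simp [psi, add_dotProduct]

theorem aux_sub_left {k : ℕ} (M : Matrix (Fin k) (Fin k) ℤ) (x y z : Fin k → ℚ) :
    psi M (x - y) z = psi M x z - psi M y z := by
  simp [psi, sub_dotProduct]

theorem aux_add_right {k : ℕ} (M : Matrix (Fin k) (Fin k) ℤ) (x y z : Fin k → ℚ) :
    psi M x (y + z) = psi M x y + psi M x z := by
  simp [psi, mulVec_add, dotProduct_add]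

theorem aux_smul_right {k : ℕ} (M : Matrix (Fin k) (Fin k) ℤ) (c : ℚ) (x y : Fin k → ℚ) :
    psi M x (c • y) = c * psi M x y := by
  simp [psi, mulVec_smul, dotProduct_smul]

theorem aux_symm {k : ℕ} (M : Matrix (Fin k) (Fin k) ℤ) (hM : M.IsSymm) (x y : Fin k → ℚ) :
    psi M x y = psi M y x := by
  have h : (M.map (fun a => (a : ℚ)))ᵀ = M.map (fun a => (a : ℚ)) := by
    rw [← transpose_map, hM.eq]
  unfold psi
  rw [dotProduct_mulVec, dotProduct_comm, ← mulVec_transpose, h]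

theorem IsIntQ.add {a b : ℚ} (ha : IsIntQ a) (hb : IsIntQ b) : IsIntQ (a + b) := by
  obtain ⟨c, rfl⟩ := ha
  obtain ⟨d, rfl⟩ := hb
  exact ⟨c + d, by push_cast; rfl⟩

theorem IsIntQ.sub {a b : ℚ} (ha : IsIntQ a) (hb : IsIntQ b) : IsIntQ (a - b) := by
  obtain ⟨c, rfl⟩ := ha
  obtain ⟨d, rfl⟩ := hb
  exact ⟨c - d, by push_cast; rfl⟩

theorem IsIntQ.mul {a b : ℚ} (ha : IsIntQ a) (hb : IsIntQ b) : IsIntQ (a * b) := by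
  obtain ⟨c, rfl⟩ := ha
  obtain ⟨d, rfl⟩ := hb
  exact ⟨c * d, by push_cast; rfl⟩

theorem aux_sum {k : ℕ} (g : Fin k → ℚ) (h : ∀ i, IsIntQ (g i)) : IsIntQ (∑ i, g i) := by
  choose c hc using h
  exact ⟨∑ i, c i, by push_cast; exact Finset.sum_congr rfl fun i _ => hc i⟩

theorem aux_int_dual {k : ℕ} (M : Matrix (Fin k) (Fin k) ℤ) (x : Fin k → ℚ)
    (hx : IsIntVec x) : InDual M x := by
  intro y hy
  unfold psi
  refine aux_sum _ fun i => (hx i).mul (aux_sum _ fun j => IsIntQ.mul ⟨M i j, rfl⟩ (hy j))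

theorem aux_basis {k : ℕ} (M : Matrix (Fin k) (Fin k) ℤ) (hM : M.IsSymm) (hd : M.det ≠ 0) :
    ∃ u : Fin k → (Fin k → ℚ), (∀ i, InDual M (u i)) ∧ (∀ i x, psi M x (u i) = x i) ∧
      ∀ r, r = ∑ i, ((M.map (fun a => (a : ℚ))) *ᵥ r) i • u i := by
  have hdet : IsUnit (M.map (fun a => (a : ℚ))).det := by
    have : (M.map (fun a => (a : ℚ))).det = (M.det : ℚ) :=
      ((Int.castRingHom ℚ).map_det M).symm
    rw [this]
    exact isUnit_iff_ne_zero.mpr (by exact_mod_cast hd)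
  set Q := M.map (fun a => (a : ℚ)) with hQ
  have key : ∀ i x, psi M x (Q⁻¹ *ᵥ Pi.single i 1) = x i := by
    intro i x
    unfold psi
    rw [← hQ, mulVec_mulVec, mul_nonsing_inv _ hdet, one_mulVec]
    simp
  refine ⟨fun i => Q⁻¹ *ᵥ Pi.single i 1, ?_, key, ?_⟩
  · intro i y hy
    rw [aux_symm M hM, key]
    exact hy i
  · intro r
    have h : Q⁻¹ *ᵥ (Q *ᵥ r) = r := by
      rw [mulVec_mulVec, nonsing_inv_mul _ hdet, one_mulVec]
    conv_lhs => rw [← h]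
    ext j
    simp [mulVec, dotProduct, mul_comm]

theorem aux_repr {k : ℕ} (M : Matrix (Fin k) (Fin k) ℤ) (hM : M.IsSymm) (hd : M.det ≠ 0)
    (L : (Fin k → ℚ) →ₗ[ℚ] ℚ) (hL : ∀ r, InDual M r → IsIntQ (L r)) :
    ∃ w, IsIntVec w ∧ ∀ r, psi M w r = L r := by
  obtain ⟨u, hu, _, hr⟩ := aux_basis M hM hd
  refine ⟨fun i => L (u i), fun i => hL _ (hu i), fun r => ?_⟩
  conv_rhs => rw [hr r]
  rw [map_sum]
  unfold psi dotProduct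
  refine Finset.sum_congr rfl fun i _ => ?_
  rw [map_smul, smul_eq_mul, mul_comm]

theorem aux_Psi {n m : ℕ} (A : Matrix (Fin n) (Fin n) ℤ) (B : Matrix (Fin m) (Fin m) ℤ)
    (f : (Fin n → ℚ) →ₗ[ℚ] (Fin m → ℚ)) (x y r : Fin n → ℚ) (z : Fin m → ℚ) :
    PsiW A B f ((x, y), z) (iota f r) =
      psi A x r + psi A y r - psi B (f y) (f r) + psi B z (f r) := by
  simp [PsiW, iota, psiR, psi]

/-- `R × R₂ = S + {((w,0),0) : w ∈ R₁}`. -/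
theorem R_R2_eq_S_plus_R1 {n m : ℕ}
    (A : Matrix (Fin n) (Fin n) ℤ) (hAsym : A.IsSymm) (hAdet : A.det ≠ 0)
    (B : Matrix (Fin m) (Fin m) ℤ) (hBsym : B.IsSymm) (hBdet : B.det ≠ 0)
    (f : (Fin n → ℚ) →ₗ[ℚ] (Fin m → ℚ))
    (hfdual : ∀ x, InDual A x → InDual B (f x))
    (hfint : ∀ x, IsIntVec x → IsIntVec (f x))
    (hfinj : ∀ x, InDual A x → IsIntVec (f x) → IsIntVec x)
    (hfsurj : ∀ z, InDual B z → ∃ x, InDual A x ∧ IsIntVec (z - f x))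
    (hfiso : ∀ x y, InDual A x → InDual A y → IsIntQ (psi B (f x) (f y) - psi A x y)) :
    (∀ w : WSp n m, IsIntVec w.1.1 ∧ InDual A w.1.2 ∧ IsIntVec w.2 →
      ∃ (s : WSp n m) (w₁ : Fin n → ℚ), InS A B f s ∧ IsIntVec w₁ ∧
        w = s + ((w₁, 0), 0)) ∧
    (∀ (s : WSp n m) (w₁ : Fin n → ℚ), InS A B f s → IsIntVec w₁ →
      IsIntVec (s + ((w₁, 0), (0 : Fin m → ℚ))).1.1 ∧
      InDual A (s + ((w₁, 0), (0 : Fin m → ℚ))).1.2 ∧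
      IsIntVec (s + ((w₁, 0), (0 : Fin m → ℚ))).2) := by
  constructor
  · rintro ⟨⟨x, y⟩, z⟩ ⟨hx, hy, hz⟩
    dsimp only at hx hy hz
    let L : (Fin n → ℚ) →ₗ[ℚ] ℚ :=
      { toFun := fun r => psi A x r + psi A y r - psi B (f y) (f r) + psi B z (f r)
        map_add' := by
          intro a b
          simp only [map_add, aux_add_right]
          ring
        map_smul' := by
          intro c a
          simp only [map_smul, aux_smul_right, RingHom.id_apply, smul_eq_mul]
          ring }
    have hLr : ∀ r, L r = psi A x r + psi A y r - psi B (f y) (f r) + psi B z (f r) :=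
      fun _ => rfl
    obtain ⟨w, hw, hwL⟩ := aux_repr A hAsym hAdet L (by
      intro r hr
      have h1 : IsIntQ (psi A x r) := by
        rw [aux_symm A hAsym]
        exact hr x hx
      have h2 : IsIntQ (psi B z (f r)) := by
        rw [aux_symm B hBsym]
        exact hfdual r hr z hz
      have h3 := (h1.add h2).sub (hfiso y r hy hr)
      rw [hLr]
      convert h3 using 1
      ring)
    refine ⟨((x - w, y), z), w, ⟨⟨⟨fun i => (hx i).sub (hw i), hy⟩,
      aux_int_dual B z hz⟩, ?_⟩, hw, ?_⟩
    · intro r hr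
      rw [aux_Psi, aux_sub_left, hwL, hLr]
      ring
    · simp
  · rintro ⟨⟨x, y⟩, z⟩ w ⟨⟨⟨hx, hy⟩, hz⟩, hS⟩ hw
    dsimp only at hx hy hz
    refine ⟨fun i => (hx i).add (hw i), by simpa using hy, ?_⟩
    have hzz : IsIntVec z := by
      obtain ⟨u, hu, hux, _⟩ := aux_basis B hBsym hBdet
      intro i
      obtain ⟨r, hr, hd⟩ := hfsurj _ (hu i)
      have h0 := hS r hr
      rw [aux_Psi] at h0
      have h1 : IsIntQ (psi A x r) := by
        rw [aux_symm A hAsym]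
        exact hr x hx
      have h2 : IsIntQ (psi B z (u i - f r)) := hz _ hd
      have h3 := (h2.add (hfiso y r hy hr)).sub h1
      have h4 : psi B z (u i) = psi B z (u i - f r) + psi B z (f r) := by
        rw [← aux_add_right, sub_add_cancel]
      rw [← hux i z, h4]
      convert h3 using 1
      linarith
    simpa using hzz
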